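/- Let f : K → K be a homeomorphism of a compact metric space K and let A : K → SL(2,ℝ) be continuous. The following are equivalent: (a) (f,A) has uniform subexponential growth, i.e. for every ε>0 there exists N∈ℕ such that ‖A_n(x)‖ ≤ e^{εn} for every x∈K and n≥N; (b) for every ε>0 there exists some n>0 such that ‖A_n(x)‖ ≤ e^{εn} for every x∈K; (c) L(f,A,μ)=0 for every f-invariant Borel probability measure μ on K. -/

import Mathlib

open MeasureTheory Filter Topology

instance : TopologicalSpace (Matrix.SpecialLinearGroup (Fin 2) ℝ) :=
  TopologicalSpace.induced (fun M => (M : Matrix (Fin 2) (Fin 2) ℝ)) inferInstance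

/-- Operator norm (w.r.t. the euclidean norm on ℝ²) of a 2×2 real matrix. -/
noncomputable def matOpNorm (M : Matrix (Fin 2) (Fin 2) ℝ) : ℝ :=
  ‖Matrix.toEuclideanCLM (𝕜 := ℝ) M‖

noncomputable def sl2Norm (M : Matrix.SpecialLinearGroup (Fin 2) ℝ) : ℝ :=
  matOpNorm (M : Matrix (Fin 2) (Fin 2) ℝ)

/-- The cocycle iterates: `cocycle f A n x = A(f^{n-1} x) ⋯ A(f x) A(x)`. -/
noncomputable def cocycle {K : Type*} (f : K → K)
    (A : K → Matrix.SpecialLinearGroup (Fin 2) ℝ) :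
    ℕ → K → Matrix.SpecialLinearGroup (Fin 2) ℝ
  | 0, _ => 1
  | (n+1), x => cocycle f A n (f x) * A x

/-- The cocycle `(f,A)` is uniformly hyperbolic. -/
def UnifHyp {K : Type*} (f : K → K) (A : K → Matrix.SpecialLinearGroup (Fin 2) ℝ) : Prop :=
  ∃ ε > (0:ℝ), ∃ N : ℕ, ∀ x : K, ∀ n ≥ N, Real.exp (ε * n) ≤ sl2Norm (cocycle f A n x)

/-- The cocycle `(f,A)` has uniform subexponential growth. -/
def UnifSubexp {K : Type*} (f : K → K) (A : K → Matrix.SpecialLinearGroup (Fin 2) ℝ) : Prop :=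
  ∀ ε > (0:ℝ), ∃ N : ℕ, ∀ x : K, ∀ n ≥ N, sl2Norm (cocycle f A n x) ≤ Real.exp (ε * n)

section SubadditiveCocycle

variable {K : Type*} {f : K → K} {u : ℕ → K → ℝ}

lemma subadditive_cocycle_mul_le (h0 : ∀ x, u 0 x = 0)
    (hsub : ∀ m n x, u (m + n) x ≤ u m (f^[n] x) + u n x)
    {n : ℕ} {c : ℝ} (hc : ∀ x, u n x ≤ c) (q : ℕ) (x : K) : u (q * n) x ≤ q * c := by
  induction q with
  | zero => simp [h0]
  | succ q ih =>
    have h := hsub n (q * n) x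
    have h' := hc (f^[q * n] x)
    rw [Nat.succ_mul, add_comm (q * n) n]
    push_cast
    linarith

lemma subadditive_cocycle_le (h0 : ∀ x, u 0 x = 0)
    (hsub : ∀ m n x, u (m + n) x ≤ u m (f^[n] x) + u n x)
    {C : ℝ} (hC : ∀ x, u 1 x ≤ C) (n : ℕ) (x : K) : u n x ≤ n * C := by
  simpa using subadditive_cocycle_mul_le h0 hsub hC n x

lemma subadditive_cocycle_uniform (h0 : ∀ x, u 0 x = 0)
    (hsub : ∀ m n x, u (m + n) x ≤ u m (f^[n] x) + u n x)
    {C : ℝ} (hC0 : 0 ≤ C) (hC : ∀ x, u 1 x ≤ C)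
    (h : ∀ ε > (0 : ℝ), ∃ n : ℕ, 0 < n ∧ ∀ x, u n x ≤ ε * n) :
    ∀ ε > (0 : ℝ), ∃ N : ℕ, ∀ x, ∀ n ≥ N, u n x ≤ ε * n := by
  intro ε hε
  obtain ⟨n, hn, hle⟩ := h (ε / 2) (half_pos hε)
  obtain ⟨N, hN⟩ := exists_nat_ge (n * C / (ε / 2))
  refine ⟨N, fun x m hm => ?_⟩
  have hsplit : m % n + m / n * n = m := by rw [mul_comm]; exact Nat.mod_add_div m n
  have hsplit' : (m % n : ℕ) + (m / n : ℕ) * (n : ℝ) = m := by exact_mod_cast hsplit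
  have h1 := hsub (m % n) (m / n * n) x
  rw [hsplit] at h1
  have h2 := subadditive_cocycle_le h0 hsub hC (m % n) (f^[m / n * n] x)
  have h3 := subadditive_cocycle_mul_le h0 hsub hle (m / n) x
  have h4 : ((m % n : ℕ) : ℝ) * C ≤ n * C := by
    gcongr
    exact (Nat.mod_lt m hn).le
  have h5 : n * C ≤ m * (ε / 2) := by
    rw [← div_le_iff₀ (half_pos hε)]
    exact hN.trans (by exact_mod_cast hm)
  have h6 : ((m / n : ℕ) : ℝ) * (ε / 2 * n) ≤ m * (ε / 2) := by
    have : 0 ≤ ((m % n : ℕ) : ℝ) := Nat.cast_nonneg _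
    nlinarith
  linarith

/-- A subadditive cocycle is controlled by the Birkhoff sums of each of its terms. -/
lemma subadditive_cocycle_mul_le_birkhoffSum (h0 : ∀ x, u 0 x = 0) (hpos : ∀ n x, 0 ≤ u n x)
    (hsub : ∀ m n x, u (m + n) x ≤ u m (f^[n] x) + u n x)
    {C : ℝ} (hC0 : 0 ≤ C) (hC : ∀ x, u 1 x ≤ C) (m n : ℕ) (hmn : m ≤ n) (x : K) :
    m * u n x ≤ birkhoffSum f (u m) n x + 2 * m * (m * C) := by
  have key : ∀ k, ∑ j ∈ Finset.range m, u (k + j) x ≤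
      ∑ j ∈ Finset.range m, u j x + birkhoffSum f (u m) k x := by
    intro k
    induction k with
    | zero => simp
    | succ k ih =>
      have h1 : ∑ j ∈ Finset.range m, u (k + 1 + j) x + u k x =
          ∑ j ∈ Finset.range m, u (k + j) x + u (k + m) x := by
        rw [← Finset.sum_range_succ (fun j => u (k + j) x), Finset.sum_range_succ']
        simp only [add_zero, add_assoc, add_comm 1]
      have h2 := hsub m k x
      rw [add_comm m k] at h2
      rw [birkhoffSum_succ]
      linarith
  have bound : ∀ j ≤ m, ∀ y, u j y ≤ m * C := fun j hj y =>
    (subadditive_cocycle_le h0 hsub hC j y).trans (by gcongr)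
  obtain ⟨k, rfl⟩ := Nat.exists_eq_add_of_le' hmn
  have h1 : m * u (k + m) x ≤ ∑ j ∈ Finset.range m, (u (k + j) x + m * C) := by
    rw [← nsmul_eq_mul]
    nth_rewrite 1 [← Finset.card_range m]
    refine Finset.card_nsmul_le_sum _ _ _ fun j hj => ?_
    have hj' := (Finset.mem_range.1 hj).le
    have h2 := hsub (m - j) (k + j) x
    rw [show m - j + (k + j) = k + m by omega] at h2
    linarith [bound (m - j) (Nat.sub_le _ _) (f^[k + j] x)]
  rw [Finset.sum_add_distrib, Finset.sum_const, Finset.card_range, nsmul_eq_mul] at h1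
  have h2 : ∑ j ∈ Finset.range m, u j x ≤ m * (m * C) := by
    rw [← nsmul_eq_mul]
    nth_rewrite 2 [← Finset.card_range m]
    exact Finset.sum_le_card_nsmul _ _ _ fun j hj => bound j (Finset.mem_range.1 hj).le x
  have h3 : birkhoffSum f (u m) k x ≤ birkhoffSum f (u m) (k + m) x := by
    rw [birkhoffSum_add]
    exact le_add_of_nonneg_right (Finset.sum_nonneg fun _ _ => hpos _ _)
  linarith [key k]

end SubadditiveCocycle

section InvariantMeasure

variable {K : Type*} [MetricSpace K] [CompactSpace K] [MeasurableSpace K] [BorelSpace K]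

/-- The uniform probability measure on the first `n + 1` points of the orbit of `x`. -/
noncomputable def empiricalMeasure (f : K → K) (n : ℕ) (x : K) : Measure K :=
  ((n + 1 : ℕ) : ENNReal)⁻¹ • ∑ k ∈ Finset.range (n + 1), Measure.dirac (f^[k] x)

instance (f : K → K) (n : ℕ) (x : K) : IsProbabilityMeasure (empiricalMeasure f n x) := by
  constructor
  simp only [empiricalMeasure, Measure.smul_apply, Measure.finsetSum_apply, measure_univ,
    Finset.sum_const, Finset.card_range, nsmul_eq_mul, mul_one, smul_eq_mul]
  exact ENNReal.inv_mul_cancel (by simp) (ENNReal.natCast_ne_top _)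

lemma integral_empiricalMeasure (f : K → K) (n : ℕ) (x : K) (g : K → ℝ) :
    ∫ y, g y ∂(empiricalMeasure f n x) = birkhoffAverage ℝ f g (n + 1) x := by
  rw [empiricalMeasure, integral_smul_measure, integral_finsetSum_measure]
  · simp [birkhoffAverage, birkhoffSum, -Nat.cast_add]
  · intro i _
    exact integrable_dirac (by simp)

/-- Krylov–Bogolyubov: empirical measures of a continuous map accumulate on an invariant
probability measure. -/
lemma exists_invariant_tendsto_birkhoffAverage {f : K → K} (hf : Continuous f) (x : ℕ → K) :
    ∃ (μ : Measure K) (F : Ultrafilter ℕ), IsProbabilityMeasure μ ∧ μ.map f = μ ∧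
      (F : Filter ℕ) ≤ atTop ∧ ∀ g : K → ℝ, Continuous g →
        Tendsto (fun n => birkhoffAverage ℝ f g (n + 1) (x n)) F (𝓝 (∫ y, g y ∂μ)) := by
  let ν : ℕ → ProbabilityMeasure K := fun n => ⟨empiricalMeasure f n (x n), inferInstance⟩
  obtain ⟨μ, -, hμ⟩ := isCompact_univ.ultrafilter_le_nhds ((hyperfilter ℕ).map ν) (by simp)
  have hF : (hyperfilter ℕ : Filter ℕ) ≤ atTop := Nat.hyperfilter_le_atTop
  have hlim : ∀ g : K → ℝ, Continuous g →
      Tendsto (fun n => birkhoffAverage ℝ f g (n + 1) (x n)) (hyperfilter ℕ)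
        (𝓝 (∫ y, g y ∂(μ : Measure K))) := by
    intro g hg
    have h := ProbabilityMeasure.tendsto_iff_forall_integral_tendsto.1
      (show Tendsto ν (hyperfilter ℕ) (𝓝 μ) from hμ)
      (BoundedContinuousFunction.mkOfCompact ⟨g, hg⟩)
    simpa [ν, integral_empiricalMeasure] using h
  refine ⟨μ, hyperfilter ℕ, inferInstance, ?_, hF, hlim⟩
  have : IsProbabilityMeasure ((μ : Measure K).map f) :=
    Measure.isProbabilityMeasure_map hf.aemeasurable
  refine ext_of_forall_integral_eq_of_IsFiniteMeasure fun g => ?_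
  rw [integral_map hf.aemeasurable g.continuous.aestronglyMeasurable]
  have hcomp := (hlim _ (g.continuous.comp hf)).sub (hlim _ g.continuous)
  have hzero : Tendsto (fun n => birkhoffAverage ℝ f (g ∘ f) (n + 1) (x n) -
      birkhoffAverage ℝ f g (n + 1) (x n)) (hyperfilter ℕ) (𝓝 0) := by
    have hdiv : Tendsto (fun n : ℕ => 2 * ‖g‖ / ((n + 1 : ℕ) : ℝ)) atTop (𝓝 0) :=
      tendsto_const_nhds.div_atTop
        (tendsto_natCast_atTop_atTop.comp (tendsto_add_atTop_nat 1))
    refine squeeze_zero_norm (fun n => ?_) (hdiv.mono_left hF)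
    have hshift : birkhoffAverage ℝ f (g ∘ f) (n + 1) (x n) =
        birkhoffAverage ℝ f g (n + 1) (f (x n)) := by
      simp only [birkhoffAverage, birkhoffSum, Function.comp_apply,
        ← Function.iterate_succ_apply' f, Function.iterate_succ_apply f]
    rw [hshift, ← dist_eq_norm, dist_birkhoffAverage_apply_birkhoffAverage]
    gcongr
    exact g.dist_le_two_norm _ _
  exact sub_eq_zero.1 (tendsto_nhds_unique hcomp hzero)

/-- If a nonnegative continuous subadditive cocycle has zero growth rate for every invariant
probability measure, then it grows sublinearly, uniformly in the base point. -/
lemma exists_subadditive_cocycle_le_of_tendsto_integral {f : K → K} (hf : Continuous f)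
    {u : ℕ → K → ℝ} (hcont : ∀ n, Continuous (u n)) (h0 : ∀ x, u 0 x = 0)
    (hpos : ∀ n x, 0 ≤ u n x) (hsub : ∀ m n x, u (m + n) x ≤ u m (f^[n] x) + u n x)
    {C : ℝ} (hC0 : 0 ≤ C) (hC : ∀ x, u 1 x ≤ C)
    (h : ∀ μ : Measure K, IsProbabilityMeasure μ → μ.map f = μ →
      Tendsto (fun n : ℕ => (n : ℝ)⁻¹ * ∫ x, u n x ∂μ) atTop (𝓝 0))
    {ε : ℝ} (hε : 0 < ε) : ∃ n : ℕ, 0 < n ∧ ∀ x, u n x ≤ ε * n := by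
  by_contra! hcon
  choose x hx using fun n : ℕ => hcon (n + 1) n.succ_pos
  obtain ⟨μ, F, hprob, hinv, hF, hlim⟩ := exists_invariant_tendsto_birkhoffAverage hf x
  have hge : ∀ m : ℕ, m * ε ≤ ∫ y, u m y ∂μ := by
    intro m
    have hdiv : Tendsto (fun n : ℕ => 2 * m * (m * C) / ((n + 1 : ℕ) : ℝ)) F (𝓝 0) :=
      (tendsto_const_nhds.div_atTop
        (tendsto_natCast_atTop_atTop.comp (tendsto_add_atTop_nat 1))).mono_left hF
    have hsum := (hlim _ (hcont m)).add hdiv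
    rw [add_zero] at hsum
    refine ge_of_tendsto hsum ?_
    filter_upwards [hF (eventually_ge_atTop m)] with n hn
    have hn0 : (0 : ℝ) < ((n + 1 : ℕ) : ℝ) := by positivity
    have hle := subadditive_cocycle_mul_le_birkhoffSum h0 hpos hsub hC0 hC m (n + 1)
      (Nat.le_succ_of_le hn) (x n)
    have hmul : (m : ℝ) * (ε * ((n + 1 : ℕ) : ℝ)) ≤ m * u (n + 1) (x n) := by
      gcongr
      exact (hx n).le
    rw [birkhoffAverage, smul_eq_mul, inv_mul_eq_div, ← add_div, le_div_iff₀ hn0]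
    linarith
  refine absurd (ge_of_tendsto (h μ hprob hinv) (b := ε) ?_) (not_le.2 hε)
  filter_upwards [eventually_gt_atTop 0] with m hm
  rw [inv_mul_eq_div, le_div_iff₀ (by exact_mod_cast hm), mul_comm]
  exact hge m

end InvariantMeasure

section SpecialLinear

lemma continuous_sl2Norm : Continuous sl2Norm := by
  have h : Continuous (Matrix.toEuclideanCLM (n := Fin 2) (𝕜 := ℝ)) :=
    LinearMap.continuous_of_finiteDimensional
      (Matrix.toEuclideanCLM (n := Fin 2) (𝕜 := ℝ)).toAlgEquiv.toLinearMap
  exact (continuous_norm.comp h).comp continuous_induced_dom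

lemma sl2Norm_one : sl2Norm 1 = 1 := by
  simp [sl2Norm, matOpNorm]

lemma sl2Norm_mul_le (M N : Matrix.SpecialLinearGroup (Fin 2) ℝ) :
    sl2Norm (M * N) ≤ sl2Norm M * sl2Norm N := by
  simp only [sl2Norm, matOpNorm, Matrix.SpecialLinearGroup.coe_mul, map_mul]
  exact norm_mul_le _ _

lemma one_le_sl2Norm (M : Matrix.SpecialLinearGroup (Fin 2) ℝ) : 1 ≤ sl2Norm M := by
  have hcol : ∀ j, M 0 j ^ 2 + M 1 j ^ 2 ≤ sl2Norm M ^ 2 := by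
    intro j
    have h := (Matrix.toEuclideanCLM (𝕜 := ℝ) (M : Matrix (Fin 2) (Fin 2) ℝ)).le_opNorm
      (EuclideanSpace.single j 1)
    have h' := pow_le_pow_left₀ (norm_nonneg _) h 2
    rw [EuclideanSpace.norm_sq_eq] at h'
    simpa [sl2Norm, matOpNorm, Fin.sum_univ_two, Matrix.ofLp_toEuclideanCLM] using h'
  have hdet : M 0 0 * M 1 1 - M 0 1 * M 1 0 = 1 := by
    rw [← Matrix.det_fin_two, M.det_coe]
  have h0 := hcol 0
  have h1 := hcol 1
  by_contra! hlt
  have hnn : 0 ≤ sl2Norm M := norm_nonneg _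
  have hsq : sl2Norm M ^ 2 < 1 := by nlinarith
  nlinarith [sq_nonneg (M 0 0 - M 1 1), sq_nonneg (M 0 1 + M 1 0)]

lemma cocycle_add {K : Type*} (f : K → K) (A : K → Matrix.SpecialLinearGroup (Fin 2) ℝ)
    (m n : ℕ) (x : K) : cocycle f A (m + n) x = cocycle f A m (f^[n] x) * cocycle f A n x := by
  induction n generalizing x with
  | zero => simp [cocycle]
  | succ n ih => rw [← add_assoc, cocycle, ih, cocycle, mul_assoc, Function.iterate_succ_apply]

lemma log_sl2Norm_cocycle_add_le {K : Type*} (f : K → K)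
    (A : K → Matrix.SpecialLinearGroup (Fin 2) ℝ) (m n : ℕ) (x : K) :
    Real.log (sl2Norm (cocycle f A (m + n) x)) ≤
      Real.log (sl2Norm (cocycle f A m (f^[n] x))) + Real.log (sl2Norm (cocycle f A n x)) := by
  have hpos := fun M => zero_lt_one.trans_le (one_le_sl2Norm M)
  rw [cocycle_add, ← Real.log_mul (hpos _).ne' (hpos _).ne']
  exact Real.log_le_log (hpos _) (sl2Norm_mul_le _ _)

lemma continuous_sl2Norm_cocycle {K : Type*} [TopologicalSpace K] {f : K → K}
    (hf : Continuous f) {A : K → Matrix.SpecialLinearGroup (Fin 2) ℝ} (hA : Continuous A)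
    (n : ℕ) : Continuous fun x => sl2Norm (cocycle f A n x) := by
  refine continuous_sl2Norm.comp (continuous_induced_rng.2 ?_)
  induction n with
  | zero => exact continuous_const
  | succ n ih => exact (ih.comp hf).matrix_mul (continuous_induced_dom.comp hA)

end SpecialLinear

/-- Equivalent characterizations of uniform subexponential growth. -/
theorem stmt_1 {K : Type*} [MetricSpace K] [CompactSpace K]
    [MeasurableSpace K] [BorelSpace K]
    (f : K ≃ₜ K) (A : C(K, Matrix.SpecialLinearGroup (Fin 2) ℝ)) :
    List.TFAE
      [ UnifSubexp (⇑f) (⇑A),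
        ∀ ε > (0:ℝ), ∃ n : ℕ, 0 < n ∧
          ∀ x : K, sl2Norm (cocycle (⇑f) (⇑A) n x) ≤ Real.exp (ε * n),
        ∀ μ : Measure K, IsProbabilityMeasure μ → Measure.map (⇑f) μ = μ →
          Tendsto (fun n : ℕ =>
              (n : ℝ)⁻¹ * ∫ x, Real.log (sl2Norm (cocycle (⇑f) (⇑A) n x)) ∂μ)
            atTop (nhds 0) ] := by
  set u : ℕ → K → ℝ := fun n x => Real.log (sl2Norm (cocycle f A n x)) with hu
  have hpos : ∀ n x, 0 ≤ u n x := fun n x => Real.log_nonneg (one_le_sl2Norm _)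
  have h0 : ∀ x, u 0 x = 0 := fun x => by simp [hu, cocycle, sl2Norm_one]
  have hsub : ∀ m n x, u (m + n) x ≤ u m (f^[n] x) + u n x := log_sl2Norm_cocycle_add_le f A
  have hcont : ∀ n, Continuous (u n) := fun n =>
    (continuous_sl2Norm_cocycle f.continuous A.continuous n).log fun x =>
      (zero_lt_one.trans_le (one_le_sl2Norm _)).ne'
  obtain ⟨C, hC0, hC⟩ : ∃ C, 0 ≤ C ∧ ∀ x, u 1 x ≤ C := by
    obtain ⟨C, hC⟩ := (isCompact_range (hcont 1)).bddAbove
    exact ⟨max C 0, le_max_right _ _,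
      fun x => (hC (Set.mem_range_self x)).trans (le_max_left _ _)⟩
  have hlog : ∀ (ε : ℝ) (n : ℕ) (x : K),
      sl2Norm (cocycle f A n x) ≤ Real.exp (ε * n) ↔ u n x ≤ ε * n := fun ε n x =>
    (Real.log_le_iff_le_exp (zero_lt_one.trans_le (one_le_sl2Norm _))).symm
  simp only [UnifSubexp, hlog]
  tfae_have 1 → 2 := by
    intro h ε hε
    obtain ⟨N, hN⟩ := h ε hε
    exact ⟨N + 1, N.succ_pos, fun x => hN x _ N.le_succ⟩
  tfae_have 2 → 1 := subadditive_cocycle_uniform h0 hsub hC0 hC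
  tfae_have 1 → 3 := by
    intro h μ hμ _
    rw [Metric.tendsto_atTop]
    intro ε hε
    obtain ⟨N, hN⟩ := h (ε / 2) (half_pos hε)
    refine ⟨N + 1, fun n hn => ?_⟩
    have hn0 : (0 : ℝ) < n := by exact_mod_cast (Nat.succ_pos N).trans_le hn
    have hint : Integrable (u n) μ :=
      (hcont n).integrable_of_hasCompactSupport (HasCompactSupport.of_compactSpace _)
    have hle : ∫ x, u n x ∂μ ≤ ε / 2 * n := by
      simpa using integral_mono hint (integrable_const (ε / 2 * n))
        fun x => hN x n (Nat.le_of_succ_le hn)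
    have hnn : 0 ≤ ∫ x, u n x ∂μ := integral_nonneg (hpos n)
    rw [Real.dist_0_eq_abs, abs_of_nonneg (by positivity), inv_mul_eq_div, div_lt_iff₀ hn0]
    nlinarith
  tfae_have 3 → 2 := fun h ε hε =>
    exists_subadditive_cocycle_le_of_tendsto_integral f.continuous hcont h0 hpos hsub hC0 hC h hε
  tfae_finish
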